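/- Let (X,d) be a complete separable metric space in which closed balls are compact and let α be a Young function. Fix n ∈ ℕ*, t ≥ 0, and a bounded continuous function f : X^n → ℝ. Then for every x ∈ X^n there exists y^x ∈ X^n with Q_{α,n}f(x) = f(y^x) + Σ_{j=1}^n α(d(x_j,y^x_j)), and for any such y^x it holds Σ_{i=1}^n α*( t·|∇⁺_i Q_{α,n}f|(x) ) ≤ t·ξ_α(t)·( Q_{α,n}f(x) − f(y^x) ). Here Q_{α,n} f(x) = inf_{y∈X^n} { f(y) + Σ_{i=1}^n α(d(x_i,y_i)) }, |∇⁺_i h|(x) = limsup_{y→x_i} [h(x₁,…,x_{i−1},y,x_{i+1},…,x_n) − h(x)]₊ / d(y,x_i) (set to 0 if x_i is isolated), α* is the Fenchel–Legendre transform of α, and ξ_α(t) = sup_{u>0} α*(t·α'₊(u)) / (t·α(u)). -/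

import Mathlib

open MeasureTheory Filter Set Topology
open scoped ENNReal NNReal

noncomputable section

/-- The right derivative of a function `α : ℝ → ℝ`. -/
def rightD (α : ℝ → ℝ) (x : ℝ) : ℝ := derivWithin α (Set.Ioi x) x

/-- The left derivative of a function `α : ℝ → ℝ`. -/
def leftD (α : ℝ → ℝ) (x : ℝ) : ℝ := derivWithin α (Set.Iio x) x

/-- A Young function: an even, convex, nonnegative function, increasing on `[0,∞)`,
vanishing at `0` and with vanishing right derivative at `0`. -/
structure IsYoung (α : ℝ → ℝ) : Prop where
  nonneg : ∀ x, 0 ≤ α x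
  even : ∀ x, α (-x) = α x
  convex : ConvexOn ℝ Set.univ α
  mono : StrictMonoOn α (Set.Ici 0)
  zero : α 0 = 0
  rightD_zero : rightD α 0 = 0

/-- The Δ₂-condition for a Young function. -/
def DeltaTwo (α : ℝ → ℝ) : Prop := ∃ K > 0, ∀ x : ℝ, α (2 * x) ≤ K * α x

/-- `r_α = inf_{x>0} x α'₋(x)/α(x)`. -/
def rAlpha (α : ℝ → ℝ) : ℝ := sInf {r : ℝ | ∃ x > 0, r = x * leftD α x / α x}

/-- `p_α = sup_{x>0} x α'₊(x)/α(x)`. -/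
def pAlpha (α : ℝ → ℝ) : ℝ := sSup {r : ℝ | ∃ x > 0, r = x * rightD α x / α x}

/-- The Fenchel-Legendre transform `α*(y) = sup_x {xy - α(x)}`, with values in `[0,∞]`. -/
def legendre (α : ℝ → ℝ) (y : ℝ) : ℝ≥0∞ := ⨆ x : ℝ, ENNReal.ofReal (x * y - α x)

/-- `ξ_α(t) = sup_{u>0} α*(t α'₊(u)) / (t α(u))`. -/
def xiAlpha (α : ℝ → ℝ) (t : ℝ) : ℝ≥0∞ :=
  ⨆ u : {u : ℝ // 0 < u}, legendre α (t * rightD α u) / ENNReal.ofReal (t * α u)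

/-- A bounded real-valued function. -/
def IsBoundedFun {Y : Type*} (f : Y → ℝ) : Prop := ∃ M, ∀ x, |f x| ≤ M

variable {X : Type*} [MetricSpace X] [MeasurableSpace X]

/-- The optimal transport cost `T_α(ν,μ)` between two measures, for the cost
function `(x,y) ↦ α(d(x,y))`. -/
def transportCost (α : ℝ → ℝ) (ν μ : Measure X) : ℝ≥0∞ :=
  sInf { c : ℝ≥0∞ | ∃ π : Measure (X × X), π.map Prod.fst = ν ∧ π.map Prod.snd = μ ∧
      c = ∫⁻ z, ENNReal.ofReal (α (dist z.1 z.2)) ∂π }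

open Classical in
/-- The relative entropy `H(ν|μ) = ∫ log (dν/dμ) dν` if `ν ≪ μ` (and `+∞` if `ν` is not
absolutely continuous with respect to `μ`, or if the integral diverges). -/
def relEnt (ν μ : Measure X) : ℝ≥0∞ :=
  if ν ≪ μ ∧ Integrable (fun x => Real.log (ν.rnDeriv μ x).toReal) ν
  then ENNReal.ofReal (∫ x, Real.log (ν.rnDeriv μ x).toReal ∂ν) else ⊤

/-- The transport-entropy inequality `T_α(C)`: for every probability measure `ν`,
`T_α(ν,μ) ≤ C H(ν|μ)`. -/
def TransportEntropy (μ : Measure X) (α : ℝ → ℝ) (C : ℝ) : Prop :=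
  ∀ ν : Measure X, IsProbabilityMeasure ν →
    transportCost α ν μ ≤ ENNReal.ofReal C * relEnt ν μ

/-- The entropy functional `Ent_μ(e^f)`. -/
def entExp (μ : Measure X) (f : X → ℝ) : ℝ :=
  ∫ x, Real.exp (f x) * Real.log (Real.exp (f x)) ∂μ
    - (∫ x, Real.exp (f x) ∂μ) * Real.log (∫ x, Real.exp (f x) ∂μ)

/-- `|∇⁺ f|(x) = limsup_{y → x} [f(y) - f(x)]₊ / d(y,x)` (equal to `0` at isolated
points by the conventions on `limsup` and `sInf` in `ℝ`). -/
def gradPlus (f : X → ℝ) (x : X) : ℝ :=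
  limsup (fun y => max (f y - f x) 0 / dist y x) (𝓝[≠] x)

/-- `|∇⁻ f|(x) = limsup_{y → x} [f(y) - f(x)]₋ / d(y,x)` (equal to `0` at isolated
points by the conventions on `limsup` and `sInf` in `ℝ`). -/
def gradMinus (f : X → ℝ) (x : X) : ℝ :=
  limsup (fun y => max (-(f y - f x)) 0 / dist y x) (𝓝[≠] x)

/-- The modified log-Sobolev inequality plus `LSI⁺_α(A)`. -/
def LSIplus (μ : Measure X) (α : ℝ → ℝ) (A : ℝ) : Prop :=
  ∀ f : X → ℝ, IsBoundedFun f → LocallyLipschitz f →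
    ENNReal.ofReal (entExp μ f) ≤
      ENNReal.ofReal A * ∫⁻ x, legendre α (gradPlus f x) * ENNReal.ofReal (Real.exp (f x)) ∂μ

/-- The modified log-Sobolev inequality minus `LSI⁻_α(A)`. -/
def LSIminus (μ : Measure X) (α : ℝ → ℝ) (A : ℝ) : Prop :=
  ∀ f : X → ℝ, IsBoundedFun f → LocallyLipschitz f →
    ENNReal.ofReal (entExp μ f) ≤
      ENNReal.ofReal A * ∫⁻ x, legendre α (gradMinus f x) * ENNReal.ofReal (Real.exp (f x)) ∂μ

/-- The inf-convolution operator `Q_α^λ f(x) = inf_y {f(y) + λ α(d(x,y))}`. -/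
def QInf (α : ℝ → ℝ) (lam : ℝ) (f : X → ℝ) (x : X) : ℝ :=
  ⨅ y : X, (f y + lam * α (dist x y))

/-- The `(τ)`-log-Sobolev inequality `(τ)-LSI_α(λ, A)`. -/
def TauLSI (μ : Measure X) (α : ℝ → ℝ) (lam A : ℝ) : Prop :=
  ∀ f : X → ℝ, IsBoundedFun f → LocallyLipschitz f →
    entExp μ f ≤ A * ∫ x, (f x - QInf α lam f x) * Real.exp (f x) ∂μ

/-- The `n`-dimensional inf-convolution operator
`Q_{α,n} f(x) = inf_y {f(y) + Σᵢ α(d(xᵢ,yᵢ))}`. -/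
def QInfN (α : ℝ → ℝ) {n : ℕ} (f : (Fin n → X) → ℝ) (x : Fin n → X) : ℝ :=
  ⨅ y : Fin n → X, (f y + ∑ i, α (dist (x i) (y i)))

/-- The `n`-dimensional sup-convolution operator
`P_{α,n} f(x) = sup_y {f(y) - Σᵢ α(d(xᵢ,yᵢ))}`. -/
def PSupN (α : ℝ → ℝ) {n : ℕ} (f : (Fin n → X) → ℝ) (x : Fin n → X) : ℝ :=
  ⨆ y : Fin n → X, (f y - ∑ i, α (dist (x i) (y i)))

end


noncomputable section
/-- The partial metric `plus`-gradient with respect to the `i`-th coordinate. -/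
def gradPlusI {X : Type*} [MetricSpace X] {n : ℕ} (h : (Fin n → X) → ℝ) (i : Fin n)
    (x : Fin n → X) : ℝ :=
  limsup (fun u => max (h (Function.update x i u) - h x) 0 / dist u (x i)) (𝓝[≠] (x i))
end

namespace IsYoung

variable {α : ℝ → ℝ}

theorem continuous (hα : IsYoung α) : Continuous α :=
  continuousOn_univ.1 (hα.convex.continuousOn isOpen_univ)

theorem monotoneOn (hα : IsYoung α) : MonotoneOn α (Ici 0) := hα.mono.monotoneOn

theorem pos (hα : IsYoung α) {u : ℝ} (hu : 0 < u) : 0 < α u := by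
  simpa [hα.zero] using hα.mono (mem_Ici.2 le_rfl) (mem_Ici.2 hu.le) hu

theorem mul_one_le (hα : IsYoung α) {r : ℝ} (hr : 1 ≤ r) : r * α 1 ≤ α r := by
  have hr0 : 0 < r := by linarith
  have h := hα.convex.2 (mem_univ r) (mem_univ 0) (inv_nonneg.2 hr0.le)
    (sub_nonneg.2 (inv_le_one_of_one_le₀ hr)) (by ring)
  simp only [smul_eq_mul, hα.zero, mul_zero, add_zero, inv_mul_cancel₀ hr0.ne'] at h
  calc r * α 1 ≤ r * (r⁻¹ * α r) := by gcongr
    _ = α r := by field_simp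

theorem exists_nonneg_le (hα : IsYoung α) (C : ℝ) : ∃ R, 0 ≤ R ∧ C ≤ α R := by
  have h1 : 0 < α 1 := hα.pos one_pos
  refine ⟨max 1 (C / α 1), le_trans zero_le_one (le_max_left _ _), ?_⟩
  calc C = C / α 1 * α 1 := by field_simp
    _ ≤ max 1 (C / α 1) * α 1 := by gcongr; exact le_max_right _ _
    _ ≤ _ := hα.mul_one_le (le_max_left _ _)

theorem hasDerivWithinAt_rightD (hα : IsYoung α) (s : ℝ) :
    HasDerivWithinAt α (rightD α s) (Ioi s) s :=
  (hα.convex.differentiableWithinAt_Ioi_of_mem_interior (by simp)).hasDerivWithinAt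

/-- The right difference quotients of `α` at `s` tend to the right derivative. -/
theorem tendsto_quotient (hα : IsYoung α) (s : ℝ) :
    Tendsto (fun r => (α (s + r) - α s) / r) (𝓝[>] 0) (𝓝 (rightD α s)) := by
  have h := (hasDerivWithinAt_iff_tendsto_slope' (by simp)).1 (hα.hasDerivWithinAt_rightD s)
  have hs : Tendsto (fun r : ℝ => s + r) (𝓝[>] 0) (𝓝[>] s) := by
    refine tendsto_nhdsWithin_iff.2 ⟨?_, ?_⟩
    · have : Tendsto (fun r : ℝ => s + r) (𝓝 0) (𝓝 (s + 0)) := by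
        exact (continuous_const.add continuous_id).tendsto 0
      rw [add_zero] at this
      exact this.mono_left nhdsWithin_le_nhds
    · filter_upwards [self_mem_nhdsWithin] with r hr
      simpa using hr
  refine (h.comp hs).congr fun r => ?_
  simp [slope_def_field]

theorem rightD_nonneg (hα : IsYoung α) {s : ℝ} (hs : 0 ≤ s) : 0 ≤ rightD α s := by
  refine ge_of_tendsto (hα.tendsto_quotient s) ?_
  filter_upwards [self_mem_nhdsWithin] with r (hr : 0 < r)
  have := hα.monotoneOn (mem_Ici.2 hs) (mem_Ici.2 (by linarith)) (show s ≤ s + r by linarith)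
  exact div_nonneg (sub_nonneg.2 this) hr.le

theorem legendre_zero (hα : IsYoung α) : legendre α 0 = 0 := by
  simp [legendre, hα.nonneg]

theorem legendre_le_legendre (hα : IsYoung α) {a b : ℝ} (ha : 0 ≤ a) (hab : a ≤ b) :
    legendre α a ≤ legendre α b := by
  refine iSup_le fun z => ?_
  rcases le_total 0 z with hz | hz
  · exact le_iSup_of_le z (ENNReal.ofReal_le_ofReal (by gcongr))
  · rw [ENNReal.ofReal_of_nonpos]
    · exact zero_le
    · linarith [mul_nonpos_of_nonpos_of_nonneg hz ha, hα.nonneg z]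

/-- The defining bound of `xiAlpha`, with the denominator cleared. -/
theorem legendre_rightD_le (hα : IsYoung α) {t s : ℝ} (ht : 0 ≤ t) (hs : 0 ≤ s) :
    legendre α (t * rightD α s) ≤ ENNReal.ofReal t * xiAlpha α t * ENNReal.ofReal (α s) := by
  rcases ht.eq_or_lt with rfl | ht
  · simp [hα.legendre_zero]
  rcases hs.eq_or_lt with rfl | hs
  · simp [hα.rightD_zero, hα.legendre_zero]
  have h : legendre α (t * rightD α s) / ENNReal.ofReal (t * α s) ≤ xiAlpha α t :=
    le_iSup (fun u : {u : ℝ // 0 < u} =>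
      legendre α (t * rightD α u) / ENNReal.ofReal (t * α u)) ⟨s, hs⟩
  rw [ENNReal.div_le_iff (by simpa using mul_pos ht (hα.pos hs)) ENNReal.ofReal_ne_top,
    ENNReal.ofReal_mul ht.le] at h
  exact h.trans_eq (by ring)

end IsYoung

section InfConvolution

variable {X : Type*} [MetricSpace X] {α : ℝ → ℝ} {n : ℕ} {f : (Fin n → X) → ℝ}

theorem QInfN_le (hα : IsYoung α) (hfb : IsBoundedFun f) (x y : Fin n → X) :
    QInfN α f x ≤ f y + ∑ i, α (dist (x i) (y i)) := by
  obtain ⟨M, hM⟩ := hfb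
  refine ciInf_le ⟨-M, ?_⟩ y
  rintro _ ⟨z, rfl⟩
  have := Finset.sum_nonneg fun i (_ : i ∈ Finset.univ) => hα.nonneg (dist (x i) (z i))
  have := (abs_le.1 (hM z)).1
  dsimp only
  linarith

/-- The infimum defining `QInfN` is attained in a proper space. -/
theorem exists_QInfN_eq [ProperSpace X] (hα : IsYoung α) (hfc : Continuous f)
    (hfb : IsBoundedFun f) (x : Fin n → X) :
    ∃ y, QInfN α f x = f y + ∑ i, α (dist (x i) (y i)) := by
  have hcont : Continuous fun y : Fin n → X => f y + ∑ i, α (dist (x i) (y i)) := by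
    have := hα.continuous
    fun_prop
  obtain ⟨M, hM⟩ := id hfb
  obtain ⟨R, hR0, hR⟩ := hα.exists_nonneg_le (2 * M)
  obtain ⟨y, hy⟩ := hcont.exists_forall_le' x (by
    filter_upwards [(isCompact_closedBall x R).compl_mem_cocompact] with z hz
    rw [mem_compl_iff, Metric.mem_closedBall, dist_comm, dist_pi_le_iff hR0] at hz
    push Not at hz
    obtain ⟨i, hi⟩ := hz
    have h1 : α (dist (x i) (z i)) ≤ ∑ j, α (dist (x j) (z j)) :=
      Finset.single_le_sum (f := fun j => α (dist (x j) (z j)))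
        (fun j _ => hα.nonneg _) (Finset.mem_univ i)
    have h2 := hα.monotoneOn (mem_Ici.2 hR0) (mem_Ici.2 dist_nonneg) hi.le
    have h3 := (abs_le.1 (hM x)).2
    have h4 := (abs_le.1 (hM z)).1
    simp only [dist_self, hα.zero, Finset.sum_const_zero]
    linarith)
  have : Nonempty (Fin n → X) := ⟨x⟩
  exact ⟨y, le_antisymm (QInfN_le hα hfb x y) (le_ciInf hy)⟩

theorem gradPlusI_nonneg (h : (Fin n → X) → ℝ) (i : Fin n) (x : Fin n → X) :
    0 ≤ gradPlusI h i x := by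
  rw [gradPlusI, limsup_eq]
  rcases eq_or_neBot (𝓝[≠] (x i)) with hbot | hne
  · simp [hbot]
  · refine Real.sInf_nonneg fun a ha => ?_
    rw [mem_ofPred_eq] at ha
    obtain ⟨u, hu⟩ := ha.exists
    exact le_trans (div_nonneg (le_max_right _ _) dist_nonneg) hu

/-- Moving one coordinate of `x` by `r` while keeping the optimal `y` raises the cost
by at most `α (s + r) - α s`. -/
theorem QInfN_update_sub_le (hα : IsYoung α) (hfb : IsBoundedFun f) {x y : Fin n → X}
    (hy : QInfN α f x = f y + ∑ i, α (dist (x i) (y i))) (i : Fin n) (u : X) :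
    QInfN α f (Function.update x i u) - QInfN α f x ≤
      α (dist (x i) (y i) + dist u (x i)) - α (dist (x i) (y i)) := by
  have h1 := QInfN_le hα hfb (Function.update x i u) y
  rw [← Finset.add_sum_erase _ _ (Finset.mem_univ i), Function.update_self,
    Finset.sum_congr rfl (g := fun j => α (dist (x j) (y j))) (fun j hj => by
      rw [Function.update_of_ne (Finset.ne_of_mem_erase hj)])] at h1
  rw [← Finset.add_sum_erase _ _ (Finset.mem_univ i)] at hy
  have h2 := hα.monotoneOn (mem_Ici.2 (dist_nonneg (x := u) (y := y i)))
    (mem_Ici.2 (by positivity : 0 ≤ dist (x i) (y i) + dist u (x i)))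
    (by linarith [dist_triangle u (x i) (y i)])
  linarith

theorem gradPlusI_QInfN_le (hα : IsYoung α) (hfb : IsBoundedFun f) {x y : Fin n → X}
    (hy : QInfN α f x = f y + ∑ i, α (dist (x i) (y i))) (i : Fin n) :
    gradPlusI (QInfN α f) i x ≤ rightD α (dist (x i) (y i)) := by
  set s := dist (x i) (y i)
  rcases eq_or_neBot (𝓝[≠] (x i)) with hbot | hne
  · simpa [gradPlusI, limsup_eq, hbot] using hα.rightD_nonneg dist_nonneg
  have hdist : Tendsto (fun u => dist u (x i)) (𝓝[≠] (x i)) (𝓝[>] 0) := by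
    refine tendsto_nhdsWithin_iff.2 ⟨?_, ?_⟩
    · have : Tendsto (fun u => dist u (x i)) (𝓝 (x i)) (𝓝 (dist (x i) (x i))) :=
        (continuous_id.dist continuous_const).tendsto (x i)
      rw [dist_self] at this
      exact this.mono_left nhdsWithin_le_nhds
    · filter_upwards [self_mem_nhdsWithin] with u hu
      exact dist_pos.2 hu
  have hlim := (hα.tendsto_quotient s).comp hdist
  rw [← hlim.limsup_eq]
  refine limsup_le_limsup (Eventually.of_forall fun u => ?_) ?_ hlim.isBoundedUnder_le
  · refine div_le_div_of_nonneg_right (max_le (QInfN_update_sub_le hα hfb hy i u) ?_)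
      dist_nonneg
    exact sub_nonneg.2 (hα.monotoneOn (mem_Ici.2 dist_nonneg)
      (mem_Ici.2 (add_nonneg dist_nonneg dist_nonneg)) (le_add_of_nonneg_right dist_nonneg))
  · exact isCoboundedUnder_le_of_le _ (x := 0)
      fun u => div_nonneg (le_max_right _ _) dist_nonneg

end InfConvolution

theorem gradient_bound_for_inf_convolution
    {X : Type*} [MetricSpace X] [CompleteSpace X] [TopologicalSpace.SeparableSpace X]
    [ProperSpace X]
    (α : ℝ → ℝ) (hα : IsYoung α)
    (n : ℕ) (hn : 0 < n) (t : ℝ) (ht : 0 ≤ t)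
    (f : (Fin n → X) → ℝ) (hfc : Continuous f) (hfb : IsBoundedFun f)
    (x : Fin n → X) :
    (∃ y : Fin n → X, QInfN α f x = f y + ∑ i, α (dist (x i) (y i))) ∧
    ∀ y : Fin n → X, QInfN α f x = f y + ∑ i, α (dist (x i) (y i)) →
      ∑ i, legendre α (t * gradPlusI (QInfN α f) i x) ≤
        ENNReal.ofReal t * xiAlpha α t * ENNReal.ofReal (QInfN α f x - f y) := by
  refine ⟨exists_QInfN_eq hα hfc hfb x, fun y hy => ?_⟩
  have hsub : QInfN α f x - f y = ∑ i, α (dist (x i) (y i)) := by linarith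
  rw [hsub, ENNReal.ofReal_sum_of_nonneg fun i _ => hα.nonneg _, Finset.mul_sum]
  refine Finset.sum_le_sum fun i _ => ?_
  calc legendre α (t * gradPlusI (QInfN α f) i x)
      ≤ legendre α (t * rightD α (dist (x i) (y i))) :=
        hα.legendre_le_legendre (mul_nonneg ht (gradPlusI_nonneg _ i x))
          (mul_le_mul_of_nonneg_left (gradPlusI_QInfN_le hα hfb hy i) ht)
    _ ≤ _ := hα.legendre_rightD_le ht dist_nonneg
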